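/- arXiv:2509.23182 — 7 statements merged into one kernel-verified Lean document; each statement's English description precedes it below -/
import Mathlib

section
/- There exists a constant C > 0 and a family of functions h̄_ε, indexed by ε ∈ (0, 1/2), with h̄_ε : (−1/ε, 1/ε) → ℝ smooth (C^∞), such that for every ε ∈ (0, 1/2): (1) h̄_ε′(x) + h̄_ε(x)² ≥ ε² for all x ∈ (−1/ε, −1] ∪ [1, 1/ε); (2) |h̄_ε′(x) + h̄_ε(x)²| ≤ C·ε for all x ∈ [−1, 1]; (3) h̄_ε′(x) < 0 for all x ∈ (−1/ε, 1/ε), h̄_ε(0) = 0, h̄_ε(x) → −∞ as x → (1/ε)⁻, and h̄_ε(x) → +∞ as x → (−1/ε)⁺; (4) for every compact set K ⊂ ℝ and every integer j ≥ 0, the j-th derivative of h̄_ε converges to 0 uniformly on K as ε → 0⁺ (where this makes sense, i.e., for ε small enough that K ⊂ (−1/ε, 1/ε)). -/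
open Filter Set

/-- The hyperbolic cotangent. -/
noncomputable def hyperbolicCot (x : ℝ) : ℝ := Real.cosh x / Real.sinh x

theorem hyperbolicCot_pos {x : ℝ} (hx : 0 < x) : 0 < hyperbolicCot x :=
  div_pos (Real.cosh_pos x) (Real.sinh_pos_iff.2 hx)

theorem one_sub_hyperbolicCot_sq {x : ℝ} (hx : 0 < x) :
    1 - hyperbolicCot x ^ 2 = -(1 / Real.sinh x ^ 2) := by
  have hs : Real.sinh x ≠ 0 := (Real.sinh_pos_iff.2 hx).ne'
  unfold hyperbolicCot
  field_simp
  linarith [Real.cosh_sq x]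

theorem hasDerivAt_hyperbolicCot {x : ℝ} (hx : 0 < x) :
    HasDerivAt hyperbolicCot (1 - hyperbolicCot x ^ 2) x := by
  have hs : Real.sinh x ≠ 0 := (Real.sinh_pos_iff.2 hx).ne'
  refine ((Real.hasDerivAt_cosh x).div (Real.hasDerivAt_sinh x) hs).congr_deriv ?_
  unfold hyperbolicCot
  field_simp

theorem contDiffOn_hyperbolicCot : ContDiffOn ℝ (⊤ : ℕ∞) hyperbolicCot (Ioi 0) :=
  Real.contDiff_cosh.contDiffOn.div Real.contDiff_sinh.contDiffOn
    fun _ hx => (Real.sinh_pos_iff.2 hx).ne'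

theorem tendsto_hyperbolicCot_nhdsGT_zero :
    Tendsto hyperbolicCot (nhdsWithin 0 (Ioi 0)) atTop := by
  have hc : Tendsto Real.cosh (nhdsWithin 0 (Ioi 0)) (nhds 1) := by
    simpa using (Real.continuous_cosh.tendsto 0).mono_left nhdsWithin_le_nhds
  have hs : Tendsto Real.sinh (nhdsWithin 0 (Ioi 0)) (nhdsWithin 0 (Ioi 0)) := by
    refine tendsto_nhdsWithin_iff.2 ⟨?_, ?_⟩
    · simpa using (Real.continuous_sinh.tendsto 0).mono_left nhdsWithin_le_nhds
    · filter_upwards [self_mem_nhdsWithin] with x hx using Real.sinh_pos_iff.2 hx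
  exact (hc.pos_mul_atTop one_pos (tendsto_inv_nhdsGT_zero.comp hs)).congr
    fun x => (div_eq_mul_inv _ _).symm

/-- A smooth monotone cutoff from `0` to `1` across `[-1, 1]`. -/
noncomputable def smoothStep (x : ℝ) : ℝ := Real.smoothTransition ((x + 1) / 2)

theorem contDiff_smoothStep : ContDiff ℝ (⊤ : ℕ∞) smoothStep :=
  Real.smoothTransition.contDiff.comp ((contDiff_id.add contDiff_const).div_const 2)

theorem monotone_smoothStep : Monotone smoothStep := fun x y hxy =>
  Real.smoothTransition.monotone (by linarith)

theorem smoothStep_nonneg (x : ℝ) : 0 ≤ smoothStep x := Real.smoothTransition.nonneg _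

theorem smoothStep_le_one (x : ℝ) : smoothStep x ≤ 1 := Real.smoothTransition.le_one _

theorem smoothStep_of_le {x : ℝ} (hx : x ≤ -1) : smoothStep x = 0 :=
  Real.smoothTransition.zero_of_nonpos (by linarith)

theorem smoothStep_of_ge {x : ℝ} (hx : 1 ≤ x) : smoothStep x = 1 :=
  Real.smoothTransition.one_of_one_le (by linarith)

theorem smoothStep_zero : smoothStep 0 = 1 / 2 := by
  have h : 0 < expNegInvGlue (1 / 2) := expNegInvGlue.pos_of_pos (by norm_num)
  have h1 : (1 : ℝ) - 1 / 2 = 1 / 2 := by norm_num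
  simp only [smoothStep, Real.smoothTransition, zero_add, h1]
  field_simp
  norm_num

theorem deriv_smoothStep_of_le {x : ℝ} (hx : x ≤ -1) : deriv smoothStep x = 0 :=
  IsLocalMin.deriv_eq_zero <| .of_forall fun y => by
    simpa only [smoothStep_of_le hx] using smoothStep_nonneg y

theorem deriv_smoothStep_of_ge {x : ℝ} (hx : 1 ≤ x) : deriv smoothStep x = 0 :=
  IsLocalMax.deriv_eq_zero <| .of_forall fun y => by
    simpa only [smoothStep_of_ge hx] using smoothStep_le_one y

/-- The bubble profile divided by its scale `t`. -/
noncomputable def scaledBubble (t x : ℝ) : ℝ :=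
  (1 - smoothStep x) * hyperbolicCot (1 + t * x) - smoothStep x * hyperbolicCot (1 - t * x)

/-- The derivative in `x` of `scaledBubble t x`. -/
noncomputable def scaledBubbleDeriv (t x : ℝ) : ℝ :=
  -(deriv smoothStep x * (hyperbolicCot (1 + t * x) + hyperbolicCot (1 - t * x))) +
    t * ((1 - smoothStep x) * (1 - hyperbolicCot (1 + t * x) ^ 2) +
      smoothStep x * (1 - hyperbolicCot (1 - t * x) ^ 2))

/-- The pairs `(t, x)` at which both hyperbolic cotangents of the profile have positive argument. -/
def bubbleDomain : Set (ℝ × ℝ) := {p | 0 < 1 + p.1 * p.2 ∧ 0 < 1 - p.1 * p.2}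

theorem isOpen_bubbleDomain : IsOpen bubbleDomain :=
  (isOpen_lt (f := fun _ => 0) (g := fun p : ℝ × ℝ => 1 + p.1 * p.2) (by fun_prop)
    (by fun_prop)).inter
  (isOpen_lt (f := fun _ => 0) (g := fun p : ℝ × ℝ => 1 - p.1 * p.2) (by fun_prop)
    (by fun_prop))

theorem mem_bubbleDomain_of_mem_Ioo {t x : ℝ} (ht : 0 < t) (hx : x ∈ Ioo (-(1 / t)) (1 / t)) :
    (t, x) ∈ bubbleDomain := by
  obtain ⟨h1, h2⟩ := hx
  have e : t * (1 / t) = 1 := by field_simp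
  have a := mul_lt_mul_of_pos_left h1 ht
  have b := mul_lt_mul_of_pos_left h2 ht
  exact ⟨by dsimp only; linarith, by dsimp only; linarith⟩

theorem contDiffOn_hyperbolicCot_one_add :
    ContDiffOn ℝ (⊤ : ℕ∞) (fun p : ℝ × ℝ => hyperbolicCot (1 + p.1 * p.2)) bubbleDomain :=
  contDiffOn_hyperbolicCot.comp (g := hyperbolicCot) (f := fun p : ℝ × ℝ => 1 + p.1 * p.2)
    (by fun_prop) fun _ hp => hp.1

theorem contDiffOn_hyperbolicCot_one_sub :
    ContDiffOn ℝ (⊤ : ℕ∞) (fun p : ℝ × ℝ => hyperbolicCot (1 - p.1 * p.2)) bubbleDomain :=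
  contDiffOn_hyperbolicCot.comp (g := hyperbolicCot) (f := fun p : ℝ × ℝ => 1 - p.1 * p.2)
    (by fun_prop) fun _ hp => hp.2

theorem contDiffOn_scaledBubble :
    ContDiffOn ℝ (⊤ : ℕ∞) (fun p : ℝ × ℝ => scaledBubble p.1 p.2) bubbleDomain := by
  have hs : ContDiffOn ℝ (⊤ : ℕ∞) (fun p : ℝ × ℝ => smoothStep p.2) bubbleDomain :=
    (contDiff_smoothStep.comp contDiff_snd).contDiffOn
  exact ((contDiffOn_const.sub hs).mul contDiffOn_hyperbolicCot_one_add).sub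
    (hs.mul contDiffOn_hyperbolicCot_one_sub)

theorem continuousOn_scaledBubbleDeriv :
    ContinuousOn (fun p : ℝ × ℝ => scaledBubbleDeriv p.1 p.2) bubbleDomain := by
  have hs : ContinuousOn (fun p : ℝ × ℝ => smoothStep p.2) bubbleDomain :=
    (contDiff_smoothStep.continuous.comp continuous_snd).continuousOn
  have hd : ContinuousOn (fun p : ℝ × ℝ => deriv smoothStep p.2) bubbleDomain :=
    ((contDiff_smoothStep.continuous_deriv (by simp)).comp continuous_snd).continuousOn
  have ha := contDiffOn_hyperbolicCot_one_add.continuousOn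
  have hb := contDiffOn_hyperbolicCot_one_sub.continuousOn
  unfold scaledBubbleDeriv
  fun_prop

theorem hasDerivAt_scaledBubble {t x : ℝ} (h : (t, x) ∈ bubbleDomain) :
    HasDerivAt (scaledBubble t) (scaledBubbleDeriv t x) x := by
  have hs : HasDerivAt smoothStep (deriv smoothStep x) x :=
    ((contDiff_smoothStep.differentiable (by simp)) x).hasDerivAt
  have hl : HasDerivAt (fun y => t * y) t x := by simpa using (hasDerivAt_id x).const_mul t
  have ha := (hasDerivAt_hyperbolicCot h.1).comp x (hl.const_add 1)
  have hb := (hasDerivAt_hyperbolicCot h.2).comp x (hl.const_sub 1)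
  refine ((hs.const_sub 1).mul ha |>.sub (hs.mul hb)).congr_deriv ?_
  simp only [scaledBubbleDeriv, Function.comp_apply]
  ring

theorem scaledBubbleDeriv_neg {t x : ℝ} (ht : 0 < t) (h : (t, x) ∈ bubbleDomain) :
    scaledBubbleDeriv t x < 0 := by
  have hd : 0 ≤ deriv smoothStep x := monotone_smoothStep.deriv_nonneg
  have ha := hyperbolicCot_pos h.1
  have hb := hyperbolicCot_pos h.2
  have hA : 1 - hyperbolicCot (1 + t * x) ^ 2 < 0 := by
    rw [one_sub_hyperbolicCot_sq h.1]
    have := Real.sinh_pos_iff.2 h.1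
    exact neg_neg_of_pos (by positivity)
  have hB : 1 - hyperbolicCot (1 - t * x) ^ 2 < 0 := by
    rw [one_sub_hyperbolicCot_sq h.2]
    have := Real.sinh_pos_iff.2 h.2
    exact neg_neg_of_pos (by positivity)
  have h1 : 0 ≤ deriv smoothStep x * (hyperbolicCot (1 + t * x) + hyperbolicCot (1 - t * x)) :=
    mul_nonneg hd (add_pos ha hb).le
  have h2 : (1 - smoothStep x) * (1 - hyperbolicCot (1 + t * x) ^ 2) +
      smoothStep x * (1 - hyperbolicCot (1 - t * x) ^ 2) < 0 := by
    rcases (smoothStep_nonneg x).eq_or_lt with h0 | h0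
    · simpa [← h0] using hA
    · have := mul_neg_of_pos_of_neg h0 hB
      have := mul_nonpos_of_nonneg_of_nonpos (sub_nonneg.2 (smoothStep_le_one x)) hA.le
      linarith
  have h3 := mul_neg_of_pos_of_neg ht h2
  unfold scaledBubbleDeriv
  linarith

theorem scaledBubble_of_ge {t x : ℝ} (hx : 1 ≤ x) :
    scaledBubble t x = -hyperbolicCot (1 - t * x) := by
  simp [scaledBubble, smoothStep_of_ge hx]

theorem scaledBubble_of_le {t x : ℝ} (hx : x ≤ -1) :
    scaledBubble t x = hyperbolicCot (1 + t * x) := by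
  simp [scaledBubble, smoothStep_of_le hx]

theorem mul_scaledBubbleDeriv_add_sq {t x : ℝ} (hx : x ≤ -1 ∨ 1 ≤ x) :
    t * scaledBubbleDeriv t x + (t * scaledBubble t x) ^ 2 = t ^ 2 := by
  rcases hx with hx | hx
  · rw [scaledBubble_of_le hx, scaledBubbleDeriv, deriv_smoothStep_of_le hx, smoothStep_of_le hx]
    ring
  · rw [scaledBubble_of_ge hx, scaledBubbleDeriv, deriv_smoothStep_of_ge hx, smoothStep_of_ge hx]
    ring

theorem exists_bound_scaledBubbleDeriv_add :
    ∃ C : ℝ, 0 < C ∧ ∀ t ∈ Icc (0 : ℝ) (1 / 2), ∀ x ∈ Icc (-1 : ℝ) 1,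
      |scaledBubbleDeriv t x + t * scaledBubble t x ^ 2| ≤ C := by
  have hsub : Icc (0 : ℝ) (1 / 2) ×ˢ Icc (-1 : ℝ) 1 ⊆ bubbleDomain := by
    rintro ⟨t, x⟩ ⟨⟨h1, h2⟩, h3, h4⟩
    dsimp only at h1 h2 h3 h4
    exact ⟨by dsimp only; nlinarith, by dsimp only; nlinarith⟩
  have hc : ContinuousOn
      (fun p : ℝ × ℝ => scaledBubbleDeriv p.1 p.2 + p.1 * scaledBubble p.1 p.2 ^ 2)
      (Icc (0 : ℝ) (1 / 2) ×ˢ Icc (-1 : ℝ) 1) := by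
    refine ContinuousOn.mono ?_ hsub
    have h1 := continuousOn_scaledBubbleDeriv
    have h2 := contDiffOn_scaledBubble.continuousOn
    fun_prop
  obtain ⟨C, hC⟩ := (isCompact_Icc.prod isCompact_Icc).exists_bound_of_continuousOn hc
  exact ⟨max C 1, by positivity, fun t ht x hx =>
    (hC (t, x) ⟨ht, hx⟩).trans (le_max_left _ _)⟩

theorem ContDiffOn.iteratedDeriv_snd {F : ℝ × ℝ → ℝ} {U : Set (ℝ × ℝ)} (hU : IsOpen U)
    (hF : ContDiffOn ℝ (⊤ : ℕ∞) F U) (j : ℕ) :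
    ContDiffOn ℝ (⊤ : ℕ∞) (fun p : ℝ × ℝ => iteratedDeriv j (fun x => F (p.1, x)) p.2) U := by
  induction j with
  | zero => simpa using hF
  | succ j ih =>
    refine ContDiffOn.congr ((ih.fderiv_of_isOpen hU le_rfl).clm_apply
      (contDiffOn_const (c := ((0 : ℝ), (1 : ℝ))))) fun p hp => ?_
    have hd := ((ih.differentiableOn (by simp)).differentiableAt (hU.mem_nhds hp)).hasFDerivAt
    have hl : HasDerivAt (fun x : ℝ => (p.1, x)) ((0 : ℝ), (1 : ℝ)) p.2 :=
      (hasDerivAt_const _ _).prodMk (hasDerivAt_id _)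
    rw [iteratedDeriv_succ]
    exact (hd.comp_hasDerivAt p.2 hl).deriv

theorem tendstoUniformlyOn_of_continuousOn_uncurry {F : ℝ → ℝ → ℝ} {U : Set (ℝ × ℝ)}
    (hU : IsOpen U) (hF : ContinuousOn (fun p : ℝ × ℝ => F p.1 p.2) U) {t₀ : ℝ} {K : Set ℝ}
    (hK : IsCompact K) (hKU : ∀ x ∈ K, (t₀, x) ∈ U) :
    TendstoUniformlyOn F (F t₀) (nhds t₀) K := by
  rw [Metric.tendstoUniformlyOn_iff]
  intro η hη
  refine hK.eventually_forall_of_forall_eventually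
    (P := fun t x => dist (F t₀ x) (F t x) < η) fun x hx => ?_
  have h1 : ContinuousAt (fun p : ℝ × ℝ => F p.1 p.2) (t₀, x) :=
    hF.continuousAt (hU.mem_nhds (hKU x hx))
  have h2 : ContinuousAt (fun p : ℝ × ℝ => F t₀ p.2) (t₀, x) :=
    ContinuousAt.comp (f := fun p : ℝ × ℝ => (t₀, p.2)) (g := fun p : ℝ × ℝ => F p.1 p.2)
      h1 (by fun_prop)
  exact (h2.dist h1).eventually_lt continuousAt_const (by simpa using hη)

/-- **Construction of the μ-bubble profile functions (Lemma 2.1 of Antonelli–Pozzetta–Xu /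
Lemma 5.2).** There is a universal constant `C > 0` and, for each `ε ∈ (0, 1/2)`, a smooth
function `h̄_ε : (-1/ε, 1/ε) → ℝ` such that:
(1) `h̄_ε' + h̄_ε² ≥ ε²` on `(-1/ε, -1] ∪ [1, 1/ε)`;
(2) `|h̄_ε' + h̄_ε²| ≤ C ε` on `[-1, 1]`;
(3) `h̄_ε' < 0` on `(-1/ε, 1/ε)`, `h̄_ε(0) = 0`, and `h̄_ε(x) → ∓∞` as `x → ±1/ε`;
(4) `h̄_ε → 0` smoothly (all derivatives, uniformly on compact sets) as `ε → 0⁺`. -/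
theorem exists_bubble_profile :
    ∃ (C : ℝ) (h : ℝ → ℝ → ℝ), 0 < C ∧
      (∀ ε : ℝ, ε ∈ Set.Ioo (0 : ℝ) (1 / 2) →
        (ContDiffOn ℝ (⊤ : ℕ∞) (h ε) (Set.Ioo (-(1 / ε)) (1 / ε))) ∧
        (∀ x ∈ Set.Ioc (-(1 / ε)) (-1 : ℝ) ∪ Set.Ico (1 : ℝ) (1 / ε),
          ε ^ 2 ≤ deriv (h ε) x + (h ε x) ^ 2) ∧
        (∀ x ∈ Set.Icc (-1 : ℝ) 1, |deriv (h ε) x + (h ε x) ^ 2| ≤ C * ε) ∧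
        (∀ x ∈ Set.Ioo (-(1 / ε)) (1 / ε), deriv (h ε) x < 0) ∧
        h ε 0 = 0 ∧
        Tendsto (h ε) (nhdsWithin (1 / ε) (Set.Iio (1 / ε))) atBot ∧
        Tendsto (h ε) (nhdsWithin (-(1 / ε)) (Set.Ioi (-(1 / ε)))) atTop) ∧
      (∀ (K : Set ℝ), IsCompact K → ∀ j : ℕ,
        TendstoUniformlyOn (fun ε : ℝ => iteratedDeriv j (h ε)) 0
          (nhdsWithin 0 (Set.Ioi 0)) K) := by
  obtain ⟨C, hC0, hC⟩ := exists_bound_scaledBubbleDeriv_add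
  have hd : ∀ {ε x : ℝ}, (ε, x) ∈ bubbleDomain →
      deriv (fun x => ε * scaledBubble ε x) x = ε * scaledBubbleDeriv ε x :=
    fun h => ((hasDerivAt_scaledBubble h).const_mul _).deriv
  have hsmooth : ContDiffOn ℝ (⊤ : ℕ∞) (fun p : ℝ × ℝ => p.1 * scaledBubble p.1 p.2)
      bubbleDomain := contDiffOn_fst.mul contDiffOn_scaledBubble
  refine ⟨C, fun ε x => ε * scaledBubble ε x, hC0, ?_, ?_⟩
  · rintro ε ⟨hε, hε'⟩
    have h2 : 2 < 1 / ε := by rw [lt_div_iff₀ hε]; linarith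
    have e : ε * (1 / ε) = 1 := by field_simp
    have hmem : ∀ x ∈ Ioo (-(1 / ε)) (1 / ε), (ε, x) ∈ bubbleDomain :=
      fun x hx => mem_bubbleDomain_of_mem_Ioo hε hx
    refine ⟨?_, ?_, ?_, ?_, ?_, ?_, ?_⟩
    · exact hsmooth.comp (g := fun p : ℝ × ℝ => p.1 * scaledBubble p.1 p.2)
        (f := fun x : ℝ => (ε, x)) (by fun_prop) hmem
    · intro x hx
      have hx' : x ∈ Ioo (-(1 / ε)) (1 / ε) ∧ (x ≤ -1 ∨ 1 ≤ x) := by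
        rcases hx with hx | hx
        · exact ⟨⟨hx.1, by linarith [hx.2]⟩, .inl hx.2⟩
        · exact ⟨⟨by linarith [hx.1], hx.2⟩, .inr hx.1⟩
      rw [hd (hmem x hx'.1)]
      exact (mul_scaledBubbleDeriv_add_sq hx'.2).ge
    · intro x hx
      rw [hd (hmem x ⟨by linarith [hx.1], by linarith [hx.2]⟩)]
      have : ε * scaledBubbleDeriv ε x + (ε * scaledBubble ε x) ^ 2 =
          (scaledBubbleDeriv ε x + ε * scaledBubble ε x ^ 2) * ε := by ring
      rw [this, abs_mul, abs_of_pos hε]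
      exact mul_le_mul_of_nonneg_right (hC ε ⟨hε.le, hε'.le⟩ x hx) hε.le
    · intro x hx
      rw [hd (hmem x hx)]
      exact mul_neg_of_pos_of_neg hε (scaledBubbleDeriv_neg hε (hmem x hx))
    · norm_num [scaledBubble, smoothStep_zero]
    · have hl : Tendsto (fun x => 1 - ε * x) (nhdsWithin (1 / ε) (Iio (1 / ε)))
          (nhdsWithin 0 (Ioi 0)) := by
        refine tendsto_nhdsWithin_iff.2 ⟨?_, ?_⟩
        · have : Continuous fun x => 1 - ε * x := by fun_prop
          have := (this.tendsto (1 / ε)).mono_left (nhdsWithin_le_nhds (s := Iio (1 / ε)))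
          rwa [e, sub_self] at this
        · filter_upwards [self_mem_nhdsWithin] with x hx
          have := mul_lt_mul_of_pos_left (mem_Iio.1 hx) hε
          exact mem_Ioi.2 (by linarith)
      refine (tendsto_neg_atTop_atBot.comp
        ((tendsto_hyperbolicCot_nhdsGT_zero.comp hl).const_mul_atTop hε)).congr' ?_
      filter_upwards [nhdsWithin_le_nhds (Ioi_mem_nhds (by linarith : 1 < 1 / ε))] with x hx
      simp [scaledBubble_of_ge (le_of_lt hx)]
    · have hl : Tendsto (fun x => 1 + ε * x) (nhdsWithin (-(1 / ε)) (Ioi (-(1 / ε))))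
          (nhdsWithin 0 (Ioi 0)) := by
        refine tendsto_nhdsWithin_iff.2 ⟨?_, ?_⟩
        · have : Continuous fun x => 1 + ε * x := by fun_prop
          have := (this.tendsto (-(1 / ε))).mono_left (nhdsWithin_le_nhds (s := Ioi (-(1 / ε))))
          rwa [mul_neg, e, add_neg_cancel] at this
        · filter_upwards [self_mem_nhdsWithin] with x hx
          have := mul_lt_mul_of_pos_left (mem_Ioi.1 hx) hε
          exact mem_Ioi.2 (by linarith)
      refine ((tendsto_hyperbolicCot_nhdsGT_zero.comp hl).const_mul_atTop hε).congr' ?_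
      filter_upwards [nhdsWithin_le_nhds (Iio_mem_nhds (by linarith : -(1 / ε) < -1))] with x hx
      simp [scaledBubble_of_le (le_of_lt hx)]
  · intro K hK j
    have h0 : iteratedDeriv j (fun x => 0 * scaledBubble 0 x) = 0 := by
      ext x
      simp
    rw [← h0]
    have hlim := tendstoUniformlyOn_of_continuousOn_uncurry isOpen_bubbleDomain
      (F := fun ε => iteratedDeriv j (fun x => ε * scaledBubble ε x)) (t₀ := 0)
      (hsmooth.iteratedDeriv_snd isOpen_bubbleDomain j).continuousOn hK
      (by simp [bubbleDomain])
    exact fun u hu => (hlim u hu).filter_mono nhdsWithin_le_nhds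
end

section
/- Let C > 0 and D > 0 be real constants and let L > π/√(CD). Then there exists a smooth (C^∞) function h : (0, L) → ℝ such that |h′(x)| < C·h(x)² + D for every x ∈ (0, L), h(x) → +∞ as x → 0⁺, and h(x) → −∞ as x → L⁻. -/
open Filter Set Real
open scoped Topology

/-- **Existence of the μ-bubble weight function (analytic core of Lemma 3.2 / Lemma 1 of
Antonelli–Xu).** For constants `C, D > 0` and any length `L > π/√(CD)`, there is a smooth
function `h : (0, L) → ℝ` with `|h'| < C h² + D` on `(0, L)`, `h → +∞` at `0⁺`
and `h → -∞` at `L⁻`. -/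
theorem exists_mu_bubble_weight (C D L : ℝ) (hC : 0 < C) (hD : 0 < D)
    (hL : Real.pi / Real.sqrt (C * D) < L) :
    ∃ h : ℝ → ℝ,
      ContDiffOn ℝ (⊤ : ℕ∞) h (Set.Ioo 0 L) ∧
      (∀ x ∈ Set.Ioo (0 : ℝ) L, |deriv h x| < C * (h x) ^ 2 + D) ∧
      Tendsto h (nhdsWithin 0 (Set.Ioi 0)) atTop ∧
      Tendsto h (nhdsWithin L (Set.Iio L)) atBot := by
  have hL0 : 0 < L := lt_of_le_of_lt (by positivity) hL
  have hw : 0 < π / L := by positivity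
  have hwL : π / L * L = π := div_mul_cancel₀ _ hL0.ne'
  have hw2 : (π / L) ^ 2 < C * D := by
    rw [← Real.lt_sqrt hw.le]
    rw [div_lt_iff₀ (by positivity)] at hL
    rw [div_lt_iff₀ hL0]
    linarith
  generalize π / L = w at *
  have hsin : ∀ x ∈ Ioo (0 : ℝ) L, 0 < sin (w * x) := fun x hx =>
    sin_pos_of_pos_of_lt_pi (mul_pos hw hx.1) (hwL ▸ mul_lt_mul_of_pos_left hx.2 hw)
  have hsin_cont : Continuous fun x => sin (w * x) := by fun_prop
  have hcos_cont : Continuous fun x => cos (w * x) := by fun_prop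
  refine ⟨fun x => w / C * (cos (w * x) * (sin (w * x))⁻¹), ?_, ?_, ?_, ?_⟩
  · have hs : ContDiffOn ℝ (⊤ : ℕ∞) (fun x => sin (w * x)) (Ioo 0 L) := by fun_prop
    have hc : ContDiffOn ℝ (⊤ : ℕ∞) (fun x => cos (w * x)) (Ioo 0 L) := by fun_prop
    exact contDiffOn_const.mul (hc.mul (hs.inv fun x hx => (hsin x hx).ne'))
  · intro x hx
    have hs := hsin x hx
    have hd : HasDerivAt (fun x => w * x) w x := by
      simpa using (hasDerivAt_id x).const_mul w
    have hderiv := (hd.cos.fun_mul (hd.sin.fun_inv hs.ne')).const_mul (w / C)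
    have hval : deriv (fun x => w / C * (cos (w * x) * (sin (w * x))⁻¹)) x
        = -(C * (w / C * (cos (w * x) * (sin (w * x))⁻¹)) ^ 2 + w ^ 2 / C) := by
      rw [hderiv.deriv]
      field_simp
      ring
    rw [hval, abs_neg, abs_of_nonneg (by positivity)]
    gcongr
    rw [div_lt_iff₀ hC]
    linarith
  · have hs : Tendsto (fun x => sin (w * x)) (𝓝[>] 0) (𝓝[>] 0) := by
      refine tendsto_nhdsWithin_iff.2 ⟨?_, ?_⟩
      · simpa using (hsin_cont.tendsto 0).mono_left nhdsWithin_le_nhds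
      · filter_upwards [Ioo_mem_nhdsGT hL0] with x hx using hsin x hx
    have hc : Tendsto (fun x => cos (w * x)) (𝓝[>] 0) (𝓝 1) := by
      simpa using (hcos_cont.tendsto 0).mono_left nhdsWithin_le_nhds
    exact (hc.pos_mul_atTop one_pos hs.inv_tendsto_nhdsGT_zero).const_mul_atTop (by positivity)
  · have hs : Tendsto (fun x => sin (w * x)) (𝓝[<] L) (𝓝[>] 0) := by
      refine tendsto_nhdsWithin_iff.2 ⟨?_, ?_⟩
      · simpa [hwL] using (hsin_cont.tendsto L).mono_left nhdsWithin_le_nhds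
      · filter_upwards [Ioo_mem_nhdsLT hL0] with x hx using hsin x hx
    have hc : Tendsto (fun x => cos (w * x)) (𝓝[<] L) (𝓝 (-1)) := by
      simpa [hwL] using (hcos_cont.tendsto L).mono_left nhdsWithin_le_nhds
    exact (hc.neg_mul_atTop neg_one_lt_zero hs.inv_tendsto_nhdsGT_zero).const_mul_atBot
      (by positivity)
end

section
/- Let n ≥ 3 be an integer, let k be a real number, let γ be a real number with 0 ≤ γ ≤ 1, and set α = kγ. Then for all real numbers X, Y, F: −F²/(n−1) + (k − 2/(n−1))·X·F + (2γ/(n−1))·Y·F − X²/(n−1) + (2γ/(n−1) − α)·X·Y + ((n−2)γ²/(n−1) − γ)·Y² ≤ −((4k − (n−1)k²)/4)·X². -/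
/-- **Pointwise algebraic inequality underlying the spectral diameter comparison
(Lemma 3.1).** For `n ≥ 3`, `k ∈ ℝ`, `0 ≤ γ ≤ 1` and `α = kγ`, for all reals `X, Y, F`:
`-F²/(n-1) + (k - 2/(n-1)) X F + (2γ/(n-1)) Y F - X²/(n-1) + (2γ/(n-1) - α) X Y
  + ((n-2)γ²/(n-1) - γ) Y² ≤ -((4k - (n-1)k²)/4) X²`. -/
theorem diameter_second_variation_algebra
    (n : ℕ) (hn : 3 ≤ n) (k γ : ℝ) (hγ0 : 0 ≤ γ) (hγ1 : γ ≤ 1) (X Y F : ℝ) :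
    -F ^ 2 / ((n : ℝ) - 1) + (k - 2 / ((n : ℝ) - 1)) * X * F
      + (2 * γ / ((n : ℝ) - 1)) * Y * F
      - X ^ 2 / ((n : ℝ) - 1) + (2 * γ / ((n : ℝ) - 1) - k * γ) * X * Y
      + (((n : ℝ) - 2) * γ ^ 2 / ((n : ℝ) - 1) - γ) * Y ^ 2
    ≤ -((4 * k - ((n : ℝ) - 1) * k ^ 2) / 4) * X ^ 2 := by
  have hm : (0 : ℝ) < (n : ℝ) - 1 := by
    have : (3 : ℝ) ≤ n := by exact_mod_cast hn
    linarith
  have hsq : 0 ≤ (F - ((((n : ℝ) - 1) * k - 2) / 2 * X + γ * Y)) ^ 2 / ((n : ℝ) - 1) := by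
    positivity
  have hY : 0 ≤ γ * (1 - γ) * Y ^ 2 :=
    mul_nonneg (mul_nonneg hγ0 (sub_nonneg.2 hγ1)) (sq_nonneg Y)
  rw [← sub_nonneg]
  refine (add_nonneg hsq hY).trans_eq ?_
  have hne := hm.ne'
  field_simp
  ring
end

section
/- Let n ≥ 3 be an integer, let γ be a real number with 0 < γ < 4/(n−1), and set ε₀ := min{1/(2(n−1)), (1/((n−3)² + 1))·(1/γ − (n−1)/4)}. Then ε₀ > 0, β₀ := γ − ((n−1)/4)·γ² − (n−3)²·γ²·ε₀ > 0, and for all real numbers X, Y: −X²/(n−1) + (2γ/(n−1) − γ)·X·Y + ((n−2)γ²/(n−1) − γ)·Y² ≤ −ε₀·X² − β₀·Y². -/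
/-- **Explicit-constant version of Claim 1 (Remark 5.5).** For `n ≥ 3`,
`0 < γ < 4/(n-1)` and `ε₀ := min(1/(2(n-1)), (1/γ - (n-1)/4)/((n-3)² + 1))`, one has
`ε₀ > 0`, `β₀ := γ - ((n-1)/4)γ² - (n-3)²γ²ε₀ > 0`, and for all reals `X, Y`:
`-X²/(n-1) + (2γ/(n-1) - γ) X Y + ((n-2)γ²/(n-1) - γ) Y² ≤ -ε₀ X² - β₀ Y²`. -/
theorem splitting_claim_one_explicit
    (n : ℕ) (hn : 3 ≤ n) (γ : ℝ) (hγ0 : 0 < γ) (hγ4 : γ < 4 / ((n : ℝ) - 1))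
    (ε₀ : ℝ)
    (hε₀ : ε₀ = min (1 / (2 * ((n : ℝ) - 1)))
      ((1 / (((n : ℝ) - 3) ^ 2 + 1)) * (1 / γ - ((n : ℝ) - 1) / 4))) :
    0 < ε₀ ∧
    0 < γ - (((n : ℝ) - 1) / 4) * γ ^ 2 - ((n : ℝ) - 3) ^ 2 * γ ^ 2 * ε₀ ∧
    ∀ X Y : ℝ,
      -X ^ 2 / ((n : ℝ) - 1) + (2 * γ / ((n : ℝ) - 1) - γ) * X * Y
        + (((n : ℝ) - 2) * γ ^ 2 / ((n : ℝ) - 1) - γ) * Y ^ 2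
      ≤ -ε₀ * X ^ 2
        - (γ - (((n : ℝ) - 1) / 4) * γ ^ 2 - ((n : ℝ) - 3) ^ 2 * γ ^ 2 * ε₀) * Y ^ 2 := by
  have hn' : (3 : ℝ) ≤ n := by exact_mod_cast hn
  obtain ⟨m, hm⟩ : ∃ m : ℝ, m = (n : ℝ) - 1 := ⟨_, rfl⟩
  have e2 : (n : ℝ) - 2 = m - 1 := by linarith
  have e3 : (n : ℝ) - 3 = m - 2 := by linarith
  have hm0 : 0 < m := by linarith
  rw [e2, e3, ← hm]
  rw [e3, ← hm] at hε₀
  rw [← hm] at hγ4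
  have hD : 0 < 1 / γ - m / 4 := by
    rw [lt_div_iff₀ hm0] at hγ4
    rw [sub_pos, lt_div_iff₀ hγ0]
    linarith
  have hk : 0 < (m - 2) ^ 2 + 1 := by positivity
  have hε_pos : 0 < ε₀ := by
    rw [hε₀]
    exact lt_min (by positivity) (by positivity)
  have hε_le : ε₀ ≤ 1 / (2 * m) := hε₀ ▸ min_le_left _ _
  have hε_mul : ε₀ * ((m - 2) ^ 2 + 1) ≤ 1 / γ - m / 4 := by
    rw [← le_div_iff₀ hk, div_eq_inv_mul, ← one_div]
    exact hε₀ ▸ min_le_right _ _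
  refine ⟨hε_pos, ?_, fun X Y => ?_⟩
  · have hβ : γ - m / 4 * γ ^ 2 - (m - 2) ^ 2 * γ ^ 2 * ε₀
        = γ ^ 2 * (1 / γ - m / 4 - (m - 2) ^ 2 * ε₀) := by
      field_simp
    rw [hβ]
    exact mul_pos (by positivity) (by linarith)
  · have hgap : 0 ≤ 1 / m - 2 * ε₀ := by
      have : 1 / m = 2 * (1 / (2 * m)) := by field_simp
      linarith
    have hsos : 0 ≤ (1 / m - 2 * ε₀) * (X + (m - 2) * γ * Y / 2) ^ 2
        + ε₀ * ((X + (m - 2) * γ * Y) ^ 2 + ((m - 2) * γ * Y) ^ 2 / 2) := by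
      positivity
    rw [← sub_nonneg]
    convert hsos using 1
    field_simp
    ring
end

section
/- Let n ≥ 3 be an integer, let γ be a real number, let ε₀ be a real number with 0 < ε₀ ≤ 1/(2(n−1)), and set β₀ := γ − ((n−1)/4)·γ² − (n−3)²·γ²·ε₀. Then the discriminant of the quadratic form (ε₀ − 1/(n−1))·X² + (2γ/(n−1) − γ)·X·Y + (β₀ + (n−2)γ²/(n−1) − γ)·Y² is nonpositive; that is, (2γ/(n−1) − γ)² − 4·(ε₀ − 1/(n−1))·(β₀ + (n−2)γ²/(n−1) − γ) ≤ 0. -/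
/-- **Discriminant computation in Claim 1 of the weighted spectral splitting theorem.**
For `n ≥ 3`, `γ ∈ ℝ`, `0 < ε₀ ≤ 1/(2(n-1))` and
`β₀ := γ - ((n-1)/4)γ² - (n-3)²γ²ε₀`, the discriminant
`(2γ/(n-1) - γ)² - 4(ε₀ - 1/(n-1))(β₀ + (n-2)γ²/(n-1) - γ)` is nonpositive. -/
theorem splitting_claim_one_discriminant
    (n : ℕ) (hn : 3 ≤ n) (γ ε₀ : ℝ) (hε₀ : 0 < ε₀)
    (hε₀' : ε₀ ≤ 1 / (2 * ((n : ℝ) - 1))) :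
    (2 * γ / ((n : ℝ) - 1) - γ) ^ 2
      - 4 * (ε₀ - 1 / ((n : ℝ) - 1)) *
        ((γ - (((n : ℝ) - 1) / 4) * γ ^ 2 - ((n : ℝ) - 3) ^ 2 * γ ^ 2 * ε₀)
          + ((n : ℝ) - 2) * γ ^ 2 / ((n : ℝ) - 1) - γ) ≤ 0 := by
  have hm : (0 : ℝ) < (n : ℝ) - 1 := by
    have : (3 : ℝ) ≤ n := by exact_mod_cast hn
    linarith
  have factored : (2 * γ / ((n : ℝ) - 1) - γ) ^ 2
      - 4 * (ε₀ - 1 / ((n : ℝ) - 1)) *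
        ((γ - (((n : ℝ) - 1) / 4) * γ ^ 2 - ((n : ℝ) - 3) ^ 2 * γ ^ 2 * ε₀)
          + ((n : ℝ) - 2) * γ ^ 2 / ((n : ℝ) - 1) - γ)
      = (γ * ((n : ℝ) - 3)) ^ 2 * ε₀ * (4 * ε₀ - 3 / ((n : ℝ) - 1)) := by
    field_simp
    ring
  have hbound : 4 * ε₀ - 3 / ((n : ℝ) - 1) ≤ 0 := by
    rw [le_div_iff₀ (by positivity)] at hε₀'
    rw [sub_nonpos, le_div_iff₀ hm]
    linarith
  rw [factored]
  exact mul_nonpos_of_nonneg_of_nonpos (by positivity) hbound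
end

section
/- Let n ≥ 3 be an integer, let γ be a real number with 0 < γ < (1/(n−1) + (n−1)/4)^{−1}, and set ε₀ := min{1/(2(n−1)), (1/((n−3)² + 1))·(1/γ − 1/(n−1) − (n−1)/4)}. Then ε₀ > 0 and, setting β₀ := γ − ((n−1)/4)·γ² − (n−3)²·γ²·ε₀ and β₁ := β₀ − γ²/(n−1), one has β₁ > 0 and for all real numbers F, Y: −F²/(n−1) + (2γ/(n−1))·Y·F − β₀·Y² = −(F − γY)²/(n−1) − β₁·Y² ≤ −β₁·Y². -/
/-- **Explicit-constant version of Claim 2 (Remark 5.7).** For `n ≥ 3`,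
`0 < γ < (1/(n-1) + (n-1)/4)⁻¹` and
`ε₀ := min(1/(2(n-1)), (1/γ - 1/(n-1) - (n-1)/4)/((n-3)² + 1))`, one has `ε₀ > 0` and,
with `β₀ := γ - ((n-1)/4)γ² - (n-3)²γ²ε₀` and `β₁ := β₀ - γ²/(n-1)`, one has `β₁ > 0`
and for all reals `F, Y`:
`-F²/(n-1) + (2γ/(n-1)) Y F - β₀ Y² = -(F - γY)²/(n-1) - β₁ Y² ≤ -β₁ Y²`. -/
theorem splitting_claim_two_explicit
    (n : ℕ) (hn : 3 ≤ n) (γ : ℝ) (hγ0 : 0 < γ)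
    (hγ : γ < (1 / ((n : ℝ) - 1) + ((n : ℝ) - 1) / 4)⁻¹)
    (ε₀ β₀ β₁ : ℝ)
    (hε₀ : ε₀ = min (1 / (2 * ((n : ℝ) - 1)))
      ((1 / (((n : ℝ) - 3) ^ 2 + 1)) * (1 / γ - 1 / ((n : ℝ) - 1) - ((n : ℝ) - 1) / 4)))
    (hβ₀ : β₀ = γ - (((n : ℝ) - 1) / 4) * γ ^ 2 - ((n : ℝ) - 3) ^ 2 * γ ^ 2 * ε₀)
    (hβ₁ : β₁ = β₀ - γ ^ 2 / ((n : ℝ) - 1)) :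
    0 < ε₀ ∧ 0 < β₁ ∧
    ∀ F Y : ℝ,
      (-F ^ 2 / ((n : ℝ) - 1) + (2 * γ / ((n : ℝ) - 1)) * Y * F - β₀ * Y ^ 2
        = -(F - γ * Y) ^ 2 / ((n : ℝ) - 1) - β₁ * Y ^ 2) ∧
      -F ^ 2 / ((n : ℝ) - 1) + (2 * γ / ((n : ℝ) - 1)) * Y * F - β₀ * Y ^ 2
        ≤ -β₁ * Y ^ 2 := by
  have hn' : (3 : ℝ) ≤ n := by exact_mod_cast hn
  have hm : 0 < (n : ℝ) - 1 := by linarith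
  have hD : 0 < 1 / γ - 1 / ((n : ℝ) - 1) - ((n : ℝ) - 1) / 4 := by
    have h := (lt_inv_comm₀ hγ0 (by positivity)).mp hγ
    rw [one_div γ]
    linarith
  have hq : 0 < ((n : ℝ) - 3) ^ 2 + 1 := by positivity
  have hε_pos : 0 < ε₀ := by
    rw [hε₀]
    exact lt_min (by positivity) (mul_pos (by positivity) hD)
  have hε_le : ε₀ * (((n : ℝ) - 3) ^ 2 + 1) ≤
      1 / γ - 1 / ((n : ℝ) - 1) - ((n : ℝ) - 1) / 4 := by
    have h := hε₀.trans_le (min_le_right _ _)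
    rwa [one_div_mul_eq_div, le_div_iff₀ hq] at h
  have hβ₁_eq : β₁ = γ ^ 2 * (1 / γ - 1 / ((n : ℝ) - 1) - ((n : ℝ) - 1) / 4
      - ((n : ℝ) - 3) ^ 2 * ε₀) := by
    rw [hβ₁, hβ₀]
    field_simp
    ring
  refine ⟨hε_pos, ?_, fun F Y => ?_⟩
  · rw [hβ₁_eq]
    exact mul_pos (by positivity) (by linarith)
  · have h_square : -F ^ 2 / ((n : ℝ) - 1) + (2 * γ / ((n : ℝ) - 1)) * Y * F - β₀ * Y ^ 2
        = -(F - γ * Y) ^ 2 / ((n : ℝ) - 1) - β₁ * Y ^ 2 := by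
      rw [hβ₁]
      ring
    refine ⟨h_square, ?_⟩
    have h_nonneg : 0 ≤ (F - γ * Y) ^ 2 / ((n : ℝ) - 1) := by positivity
    rw [h_square, neg_div]
    linarith
end

section
/- Let n ≥ 3 be an integer and let γ be a real number with 0 < γ < (1/(n−1) + (n−1)/4)^{−1}. Then there exist real numbers ε₀ > 0 and β₁ > 0, depending only on n and γ, such that for all real numbers X, Y, F: −X²/(n−1) + (2γ/(n−1) − γ)·X·Y + ((n−2)γ²/(n−1) − γ)·Y² − F²/(n−1) + (2γ/(n−1))·Y·F ≤ −ε₀·X² − β₁·Y². -/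
/-- A positive definite binary quadratic form `X² + bXY + cY²` is bounded below by a
positive diagonal form. -/
lemma diagonal_le_quadratic_form {b c : ℝ} (hc : 0 < c) (X Y : ℝ) :
    (4 * c - b ^ 2) / (8 * c) * X ^ 2 + (4 * c - b ^ 2) / 8 * Y ^ 2
      ≤ X ^ 2 + b * X * Y + c * Y ^ 2 := by
  have key : X ^ 2 + b * X * Y + c * Y ^ 2
      - ((4 * c - b ^ 2) / (8 * c) * X ^ 2 + (4 * c - b ^ 2) / 8 * Y ^ 2)
      = ((b * X + 2 * c * Y) ^ 2 + c * (2 * X + b * Y) ^ 2) / (8 * c) := by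
    field_simp
    ring
  have : 0 ≤ ((b * X + 2 * c * Y) ^ 2 + c * (2 * X + b * Y) ^ 2) / (8 * c) := by positivity
  linarith


/-- **Combined pointwise estimate (Claims 1 and 2 together).** For `n ≥ 3` and
`0 < γ < (1/(n-1) + (n-1)/4)⁻¹`, there exist `ε₀ > 0` and `β₁ > 0` such that for all
reals `X, Y, F`:
`-X²/(n-1) + (2γ/(n-1) - γ) X Y + ((n-2)γ²/(n-1) - γ) Y² - F²/(n-1) + (2γ/(n-1)) Y F
  ≤ -ε₀ X² - β₁ Y²`. -/
theorem splitting_combined_estimate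
    (n : ℕ) (hn : 3 ≤ n) (γ : ℝ) (hγ0 : 0 < γ)
    (hγ : γ < (1 / ((n : ℝ) - 1) + ((n : ℝ) - 1) / 4)⁻¹) :
    ∃ ε₀ β₁ : ℝ, 0 < ε₀ ∧ 0 < β₁ ∧
      ∀ X Y F : ℝ,
        -X ^ 2 / ((n : ℝ) - 1) + (2 * γ / ((n : ℝ) - 1) - γ) * X * Y
          + (((n : ℝ) - 2) * γ ^ 2 / ((n : ℝ) - 1) - γ) * Y ^ 2
          - F ^ 2 / ((n : ℝ) - 1) + (2 * γ / ((n : ℝ) - 1)) * Y * F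
        ≤ -ε₀ * X ^ 2 - β₁ * Y ^ 2 := by
  obtain ⟨m, hm⟩ : ∃ m : ℝ, m = (n : ℝ) - 1 := ⟨_, rfl⟩
  have hm2 : 2 ≤ m := by
    have : (3 : ℝ) ≤ n := by exact_mod_cast hn
    linarith
  have hn2 : (n : ℝ) - 2 = m - 1 := by linarith
  rw [← hm] at hγ
  simp only [← hm, hn2]
  have hm0 : 0 < m := by linarith
  have hγm : γ * (m ^ 2 + 4) < 4 * m := by
    rw [lt_inv_comm₀ hγ0 (by positivity), ← one_div, lt_div_iff₀ hγ0] at hγ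
    have := mul_lt_mul_of_pos_right hγ (by positivity : 0 < 4 * m)
    have e : (1 / m + m / 4) * γ * (4 * m) = γ * (m ^ 2 + 4) := by
      field_simp
      ring
    linarith
  have hγ1 : γ < 1 := by nlinarith [mul_nonneg hγ0.le (sq_nonneg (m - 2))]
  obtain ⟨b, hb⟩ : ∃ b : ℝ, b = γ * (m - 2) := ⟨_, rfl⟩
  obtain ⟨c, hc⟩ : ∃ c : ℝ, c = m * γ * (1 - γ) := ⟨_, rfl⟩
  have hc0 : 0 < c := hc ▸ mul_pos (mul_pos hm0 hγ0) (sub_pos.2 hγ1)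
  have hD : 0 < 4 * c - b ^ 2 := by
    have : 4 * c - b ^ 2 = γ * (4 * m - γ * (m ^ 2 + 4)) := by
      rw [hb, hc]
      ring
    rw [this]
    exact mul_pos hγ0 (sub_pos.2 hγm)
  refine ⟨(4 * c - b ^ 2) / (8 * c) / m, (4 * c - b ^ 2) / 8 / m, by positivity, by positivity,
    fun X Y F => ?_⟩
  have h := div_le_div_of_nonneg_right (diagonal_le_quadratic_form (b := b) hc0 X Y) hm0.le
  have hF : 0 ≤ (F - γ * Y) ^ 2 / m := by positivity
  have key : -X ^ 2 / m + (2 * γ / m - γ) * X * Y + ((m - 1) * γ ^ 2 / m - γ) * Y ^ 2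
      - F ^ 2 / m + (2 * γ / m) * Y * F
      = -((X ^ 2 + b * X * Y + c * Y ^ 2) / m) - (F - γ * Y) ^ 2 / m := by
    rw [hb, hc]
    field_simp
    ring
  rw [key]
  have e : ((4 * c - b ^ 2) / (8 * c) * X ^ 2 + (4 * c - b ^ 2) / 8 * Y ^ 2) / m
      = (4 * c - b ^ 2) / (8 * c) / m * X ^ 2 + (4 * c - b ^ 2) / 8 / m * Y ^ 2 := by ring
  linarith
end
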